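/- Let (X, d) be a complete metric space, let α, β, γ, δ, ε, ζ : X×X → ℝ, and let T : X → X be an (α, β, γ, δ, ε, ζ)-weighted generalized pseudocontraction. Suppose there exist λ : X×X → [0,1] and A ∈ (0,1) such that for all x, y ∈ X, at least one of the following holds: (i) α_λ(x,y) + ζ_λ(x,y) + 2·min{β_λ(x,y), 0} > 0 and −(δ_λ(x,y) + ε_λ(x,y) + 2·min{β_λ(x,y), 0})/(α_λ(x,y) + ζ_λ(x,y) + 2·min{β_λ(x,y), 0}) ≤ A; or (ii) α_λ(y,x) + ε_λ(y,x) + 2·min{γ_λ(y,x), 0} > 0 and −(δ_λ(y,x) + ζ_λ(y,x) + 2·min{γ_λ(y,x), 0})/(α_λ(y,x) + ε_λ(y,x) + 2·min{γ_λ(y,x), 0}) ≤ A. Then for every x ∈ X the sequence (Tⁿx)_{n∈ℕ} converges to a point of X. -/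

import Mathlib

open Filter Topology

/-- `T` is an `(α, β, γ, δ, ε, ζ)`-weighted generalized pseudocontraction. -/
def IsWGPseudocontraction {X : Type*} [MetricSpace X]
    (T : X → X) (α β γ δ ε ζ : X → X → ℝ) : Prop :=
  ∀ x y : X,
    α x y * dist (T x) (T y) ^ 2 + β x y * dist x (T y) ^ 2 +
      γ x y * dist (T x) y ^ 2 + δ x y * dist x y ^ 2 +
      ε x y * dist x (T x) ^ 2 + ζ x y * dist y (T y) ^ 2 ≤ 0

/-- The `l`-weighted combination of two coefficient maps:
`(f, g) ↦ (x, y) ↦ (1 − l(x,y))·f(x,y) + l(x,y)·g(y,x)`.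
With it: `α_λ = wComb l α α`, `β_λ = wComb l β γ`, `γ_λ = wComb l γ β`,
`δ_λ = wComb l δ δ`, `ε_λ = wComb l ε ζ`, `ζ_λ = wComb l ζ ε`. -/
def wComb {X : Type*} (l f g : X → X → ℝ) : X → X → ℝ :=
  fun x y => (1 - l x y) * f x y + l x y * g y x

/-- The symmetrized coefficients satisfy the same pseudocontraction inequality. -/
theorem IsWGPseudocontraction.symmetrize {X : Type*} [MetricSpace X]
    {T : X → X} {α β γ δ ε ζ : X → X → ℝ} (hT : IsWGPseudocontraction T α β γ δ ε ζ)
    {l : X → X → ℝ} (hl : ∀ x y, l x y ∈ Set.Icc (0 : ℝ) 1) :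
    IsWGPseudocontraction T (wComb l α α) (wComb l β γ) (wComb l γ β)
      (wComb l δ δ) (wComb l ε ζ) (wComb l ζ ε) := by
  intro x y
  have hxy := mul_nonpos_of_nonneg_of_nonpos (sub_nonneg.2 (hl x y).2) (hT x y)
  have hyx := mul_nonpos_of_nonneg_of_nonpos (hl x y).1 (hT y x)
  rw [dist_comm (T y) (T x), dist_comm y (T x), dist_comm (T y) x, dist_comm y x] at hyx
  simp only [wComb]
  linarith

/-- If `p b² + q c² + r a² ≤ 0` where `c ≤ a + b`, then `b² ≤ A a²` as soon as the
coefficients obtained from `c² ≤ 2 (a² + b²)` have a quotient bounded by `A`. -/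
theorem sq_le_mul_sq_of_weighted_sum_nonpos {p q r a b c A : ℝ} (hc : 0 ≤ c) (hcab : c ≤ a + b)
    (h : p * b ^ 2 + q * c ^ 2 + r * a ^ 2 ≤ 0) (hpos : 0 < p + 2 * min q 0)
    (hA : -((r + 2 * min q 0) / (p + 2 * min q 0)) ≤ A) : b ^ 2 ≤ A * a ^ 2 := by
  have hc2 : c ^ 2 ≤ 2 * (a ^ 2 + b ^ 2) := by nlinarith [sq_nonneg (a - b)]
  have hq : min q 0 * (2 * (a ^ 2 + b ^ 2)) ≤ q * c ^ 2 :=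
    (mul_le_mul_of_nonpos_left hc2 (min_le_right q 0)).trans
      (mul_le_mul_of_nonneg_right (min_le_left q 0) (sq_nonneg c))
  rw [← neg_div, div_le_iff₀ hpos] at hA
  have ha := mul_le_mul_of_nonneg_right hA (sq_nonneg a)
  refine le_of_mul_le_mul_left ?_ hpos
  linarith

/-- In a complete space, the Picard iterates of a map that contracts consecutive distances
converge. -/
theorem exists_tendsto_iterate_of_dist_sq_le {X : Type*} [MetricSpace X] [CompleteSpace X]
    {T : X → X} {A : ℝ} (hA : A ∈ Set.Ioo (0 : ℝ) 1)
    (h : ∀ x, dist (T x) (T (T x)) ^ 2 ≤ A * dist x (T x) ^ 2) (x : X) :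
    ∃ u : X, Tendsto (fun n : ℕ => T^[n] x) atTop (𝓝 u) := by
  have hstep : ∀ y, dist (T y) (T (T y)) ≤ √A * dist y (T y) := fun y => by
    refine (pow_le_pow_iff_left₀ dist_nonneg (by positivity) two_ne_zero).1 ?_
    rw [mul_pow, Real.sq_sqrt hA.1.le]
    exact h y
  refine cauchySeq_tendsto_of_complete
    (cauchySeq_of_le_geometric (√A) (dist x (T x)) ((Real.sqrt_lt' one_pos).2 (by simpa using hA.2))
      fun n => ?_)
  induction n with
  | zero => simp
  | succ n ih =>
    simp only [Function.iterate_succ_apply'] at ih ⊢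
    calc _ ≤ √A * dist (T^[n] x) (T (T^[n] x)) := hstep _
      _ ≤ √A * (dist x (T x) * √A ^ n) := by gcongr
      _ = _ := by ring

theorem stmt_8 {X : Type*} [MetricSpace X] [CompleteSpace X]
    (α β γ δ ε ζ : X → X → ℝ)
    (T : X → X) (hT : IsWGPseudocontraction T α β γ δ ε ζ)
    (h : ∃ (l : X → X → ℝ) (A : ℝ), (∀ x y : X, l x y ∈ Set.Icc (0 : ℝ) 1) ∧
      A ∈ Set.Ioo (0 : ℝ) 1 ∧
      ∀ x y : X,
        (0 < wComb l α α x y + wComb l ζ ε x y + 2 * min (wComb l β γ x y) 0 ∧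
          -((wComb l δ δ x y + wComb l ε ζ x y + 2 * min (wComb l β γ x y) 0) /
              (wComb l α α x y + wComb l ζ ε x y + 2 * min (wComb l β γ x y) 0)) ≤ A) ∨
        (0 < wComb l α α y x + wComb l ε ζ y x + 2 * min (wComb l γ β y x) 0 ∧
          -((wComb l δ δ y x + wComb l ζ ε y x + 2 * min (wComb l γ β y x) 0) /
              (wComb l α α y x + wComb l ε ζ y x + 2 * min (wComb l γ β y x) 0)) ≤ A)) :
    ∀ x : X, ∃ u : X, Tendsto (fun n : ℕ => T^[n] x) atTop (𝓝 u) := by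
  obtain ⟨l, A, hl, hA, h⟩ := h
  refine exists_tendsto_iterate_of_dist_sq_le hA fun x => ?_
  have hcomb := hT.symmetrize hl
  have htri := dist_triangle x (T x) (T (T x))
  rcases h x (T x) with ⟨hpos, hle⟩ | ⟨hpos, hle⟩
  · refine sq_le_mul_sq_of_weighted_sum_nonpos dist_nonneg htri ?_ hpos hle
    have hx := hcomb x (T x)
    rw [dist_self] at hx
    linarith
  · refine sq_le_mul_sq_of_weighted_sum_nonpos dist_nonneg htri ?_ hpos hle
    have hx := hcomb (T x) x
    rw [dist_self, dist_comm (T (T x)) (T x), dist_comm (T (T x)) x, dist_comm (T x) x] at hx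
    linarith
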